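/- Let X be a compact subset of ℝⁿ and let r : X × X → ℝ^{d_r} be a continuous function. Then for every ε > 0 there exist a dimension d ∈ ℕ and, for each i = 1,…,d_r, single-hidden-layer ReLU networks φ⁽ⁱ⁾, ψ⁽ⁱ⁾ : X → ℝ^d (each component of φ⁽ⁱ⁾ and ψ⁽ⁱ⁾ being a finite linear combination of functions of the form x ↦ max(0, ⟨w, x⟩ + b) with w ∈ ℝⁿ, b ∈ ℝ) such that the model r̂(x,y) := (⟨φ⁽¹⁾(x), ψ⁽¹⁾(y)⟩, …, ⟨φ^{(d_r)}(x), ψ^{(d_r)}(y)⟩) satisfies sup_{x,y ∈ X} ‖r(x,y) − r̂(x,y)‖_∞ < ε. -/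

import Mathlib

open scoped RealInnerProductSpace

/-- Taylor's formula for `exp` at `a` with integral remainder, the kernel being a rectifier. -/
lemma integral_exp_mul_relu {a c t : ℝ} (hat : a ≤ t) (htc : t ≤ c) :
    ∫ s in a..c, Real.exp s * max 0 (t - s) = Real.exp t - Real.exp a * (1 + t - a) := by
  have hcont : Continuous fun s : ℝ => Real.exp s * max 0 (t - s) := by fun_prop
  rw [← intervalIntegral.integral_add_adjacent_intervals
    (hcont.intervalIntegrable a t) (hcont.intervalIntegrable t c)]
  have h₁ : ∫ s in a..t, Real.exp s * max 0 (t - s) = ∫ s in a..t, Real.exp s * (t - s) := by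
    refine intervalIntegral.integral_congr fun s hs => ?_
    rw [Set.uIcc_of_le hat] at hs
    simp only [max_eq_right (sub_nonneg.2 hs.2)]
  have h₂ : ∫ s in t..c, Real.exp s * max 0 (t - s) = 0 := by
    rw [intervalIntegral.integral_congr (g := fun _ => (0 : ℝ))]
    · simp
    · intro s hs
      rw [Set.uIcc_of_le htc] at hs
      simp only [max_eq_left (sub_nonpos.2 hs.1), mul_zero]
  have h₃ : ∫ s in a..t, Real.exp s * (t - s) =
      Real.exp t * (1 + t - t) - Real.exp a * (1 + t - a) := by
    refine intervalIntegral.integral_eq_sub_of_hasDerivAt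
      (f := fun s => Real.exp s * (1 + t - s)) (fun s _ => ?_) ?_
    · exact ((Real.hasDerivAt_exp s).mul ((hasDerivAt_id' s).const_sub (1 + t))).congr_deriv
        (by ring)
    · exact (by fun_prop : Continuous fun s : ℝ => Real.exp s * (t - s)).intervalIntegrable _ _
  rw [h₁, h₂, h₃]
  ring

/-- The interval integral of a continuous function with values in a closed subspace stays there. -/
lemma Submodule.intervalIntegral_mem {E : Type*} [NormedAddCommGroup E] [NormedSpace ℝ E]
    [CompleteSpace E] (T : Submodule ℝ E) (hT : IsClosed (T : Set E)) {F : ℝ → E}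
    (hF : Continuous F) (hFT : ∀ s, F s ∈ T) (a c : ℝ) : ∫ s in a..c, F s ∈ T := by
  have : CompleteSpace T := hT.completeSpace_coe
  have hG : Continuous fun s => (⟨F s, hFT s⟩ : T) := hF.subtype_mk hFT
  have h : ∫ s in a..c, F s = T.subtypeL (∫ s in a..c, (⟨F s, hFT s⟩ : T)) :=
    T.subtypeL.intervalIntegral_comp_comm
      (hG.intervalIntegrable (μ := MeasureTheory.volume) a c)
  rw [h]
  exact Subtype.property _

/-- The rectifier applied to a continuous function. -/
def reluMap {Z : Type*} [TopologicalSpace Z] (f : C(Z, ℝ)) : C(Z, ℝ) :=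
  ⟨fun z => max 0 (f z), by fun_prop⟩

@[simp]
lemma reluMap_apply {Z : Type*} [TopologicalSpace Z] (f : C(Z, ℝ)) (z : Z) :
    reluMap f z = max 0 (f z) := rfl

/-- The exponential of a continuous function. -/
noncomputable def expMap {Z : Type*} [TopologicalSpace Z] (f : C(Z, ℝ)) : C(Z, ℝ) :=
  ⟨fun z => Real.exp (f z), by fun_prop⟩

@[simp]
lemma expMap_apply {Z : Type*} [TopologicalSpace Z] (f : C(Z, ℝ)) (z : Z) :
    expMap f z = Real.exp (f z) := rfl

/-- A closed subspace containing `h * relu (σ L + b)` for all `σ`, `b` contains `h * exp L`. -/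
lemma mul_expMap_mem {Z : Type*} [TopologicalSpace Z] [CompactSpace Z]
    (T : Submodule ℝ C(Z, ℝ)) (hT : IsClosed (T : Set C(Z, ℝ))) (h L : C(Z, ℝ))
    (hmem : ∀ σ b : ℝ, h * reluMap (σ • L + b • 1) ∈ T) : h * expMap L ∈ T := by
  set R := ‖L‖
  let F : ℝ → C(Z, ℝ) := fun s => Real.exp s • (h * reluMap ((1 : ℝ) • L + (-s) • 1))
  have hF : Continuous F := by
    refine ContinuousMap.continuous_of_continuous_uncurry _ ?_
    simp only [F, Function.uncurry_def, ContinuousMap.smul_apply, ContinuousMap.mul_apply,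
      reluMap_apply, ContinuousMap.add_apply, ContinuousMap.one_apply]
    fun_prop
  have hI := T.intervalIntegral_mem hT hF (fun s => T.smul_mem _ (hmem _ _)) (-R) R
  have key : h * expMap L = (∫ s in (-R)..R, F s)
      + (Real.exp (-R) * (1 + R)) • (h * reluMap ((0 : ℝ) • L + (1 : ℝ) • 1))
      + Real.exp (-R) • (h * reluMap ((1 : ℝ) • L + (0 : ℝ) • 1)
        - h * reluMap ((-1 : ℝ) • L + (0 : ℝ) • 1)) := by
    ext z
    have hz : |L z| ≤ R := L.norm_coe_le_norm z
    have heval : (∫ s in (-R)..R, F s) z = ∫ s in (-R)..R, F s z :=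
      ((ContinuousMap.evalCLM ℝ z).intervalIntegral_comp_comm
        (hF.intervalIntegrable (μ := MeasureTheory.volume) (-R) R)).symm
    have hFz : ∀ s, F s z = h z * (Real.exp s * max 0 (L z - s)) := fun s => by
      simp only [F, ContinuousMap.smul_apply, ContinuousMap.mul_apply, reluMap_apply,
        ContinuousMap.add_apply, ContinuousMap.one_apply, smul_eq_mul, one_mul, mul_one,
        ← sub_eq_add_neg]
      ring
    have hmax : max 0 (L z) - max 0 (-L z) = L z := by
      rcases le_total 0 (L z) with h0 | h0
      · rw [max_eq_right h0, max_eq_left (by linarith)]; ring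
      · rw [max_eq_left h0, max_eq_right (by linarith)]; ring
    simp only [ContinuousMap.add_apply, heval, hFz, intervalIntegral.integral_const_mul,
      integral_exp_mul_relu (abs_le.1 hz).1 (abs_le.1 hz).2, ContinuousMap.smul_apply,
      ContinuousMap.mul_apply, reluMap_apply, ContinuousMap.sub_apply, expMap_apply,
      ContinuousMap.one_apply, smul_eq_mul, zero_mul, zero_add, one_mul, mul_one, add_zero,
      max_eq_right zero_le_one, neg_mul, ← mul_sub, hmax]
    ring
  rw [key]
  exact T.add_mem (T.add_mem hI (T.smul_mem _ (hmem _ _)))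
    (T.smul_mem _ (T.sub_mem (hmem _ _) (hmem _ _)))

section Products

variable {E : Type*} [NormedAddCommGroup E] [InnerProductSpace ℝ E] (X : Set E)

/-- The function `(x, y) ↦ ⟪w, x⟫` on `X × X`. -/
def innerFst (w : E) : C(X × X, ℝ) := ⟨fun z => ⟪w, (z.1 : E)⟫, by fun_prop⟩

/-- The function `(x, y) ↦ ⟪v, y⟫` on `X × X`. -/
def innerSnd (v : E) : C(X × X, ℝ) := ⟨fun z => ⟪v, (z.2 : E)⟫, by fun_prop⟩

/-- The product of a ReLU neuron in `x` and a ReLU neuron in `y`, as a function on `X × X`. -/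
def reluProd (p : (E × ℝ) × (E × ℝ)) : C(X × X, ℝ) :=
  reluMap (innerFst X p.1.1 + p.1.2 • 1) * reluMap (innerSnd X p.2.1 + p.2.2 • 1)

@[simp]
lemma innerFst_apply (w : E) (z : X × X) : innerFst X w z = ⟪w, (z.1 : E)⟫ := rfl

@[simp]
lemma innerSnd_apply (v : E) (z : X × X) : innerSnd X v z = ⟪v, (z.2 : E)⟫ := rfl

lemma smul_innerFst (σ : ℝ) (w : E) : σ • innerFst X w = innerFst X (σ • w) := by
  ext z
  simp [real_inner_smul_left]

lemma smul_innerSnd (σ : ℝ) (v : E) : σ • innerSnd X v = innerSnd X (σ • v) := by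
  ext z
  simp [real_inner_smul_left]

/-- The functions `(x, y) ↦ exp ⟪w, x⟫ * exp ⟪v, y⟫` form a multiplicative monoid. -/
def expProdSubmonoid : Submonoid C(X × X, ℝ) where
  carrier := Set.range fun p : E × E => expMap (innerFst X p.1) * expMap (innerSnd X p.2)
  one_mem' := ⟨0, by ext z; simp⟩
  mul_mem' := by
    rintro _ _ ⟨p, rfl⟩ ⟨q, rfl⟩
    refine ⟨p + q, ?_⟩
    ext z
    simp only [ContinuousMap.mul_apply, expMap_apply, innerFst_apply, innerSnd_apply,
      Prod.fst_add, Prod.snd_add, inner_add_left, Real.exp_add]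
    ring

lemma expProd_separatesPoints :
    (Algebra.adjoin ℝ (expProdSubmonoid X : Set C(X × X, ℝ))).SeparatesPoints := by
  intro z z' hne
  by_contra! hcon
  have hsep : ∀ p : E × E, (expMap (innerFst X p.1) * expMap (innerSnd X p.2)) z =
      (expMap (innerFst X p.1) * expMap (innerSnd X p.2)) z' := fun p =>
    hcon _ ⟨_, Algebra.subset_adjoin ⟨p, rfl⟩, rfl⟩
  refine hne (Prod.ext (Subtype.ext (ext_inner_left ℝ fun w => ?_))
    (Subtype.ext (ext_inner_left ℝ fun v => ?_)))
  · simpa using hsep (w, 0)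
  · simpa using hsep (0, v)

/-- Products of a ReLU neuron in `x` and one in `y` span a dense subspace of `C(X × X, ℝ)`. -/
lemma topologicalClosure_span_reluProd [CompactSpace X] :
    (Submodule.span ℝ (Set.range (reluProd X))).topologicalClosure = ⊤ := by
  set T := (Submodule.span ℝ (Set.range (reluProd X))).topologicalClosure
  have hT : IsClosed (T : Set C(X × X, ℝ)) := Submodule.isClosed_topologicalClosure _
  have hrelu : ∀ p, reluProd X p ∈ T := fun p =>
    Submodule.le_topologicalClosure _ (Submodule.subset_span ⟨p, rfl⟩)
  have hexp : ∀ w v, expMap (innerFst X w) * expMap (innerSnd X v) ∈ T := fun w v => by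
    refine mul_expMap_mem T hT _ _ fun σ b => ?_
    rw [mul_comm, smul_innerSnd]
    refine mul_expMap_mem T hT _ _ fun σ' b' => ?_
    rw [mul_comm, smul_innerFst]
    exact hrelu ((_, _), (_, _))
  have hle : Subalgebra.toSubmodule
      (Algebra.adjoin ℝ (expProdSubmonoid X : Set C(X × X, ℝ))) ≤ T := by
    rw [Algebra.adjoin_eq_span, Submonoid.closure_eq, Submodule.span_le]
    rintro _ ⟨p, rfl⟩
    exact hexp p.1 p.2
  refine eq_top_iff.2 fun f _ => ?_
  have hf := ContinuousMap.continuousMap_mem_subalgebra_closure_of_separatesPoints _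
    (expProd_separatesPoints X) f
  exact closure_minimal hle hT hf

end Products

/-- **Universal approximation of relation functions by inner products of
single-hidden-layer ReLU networks (vector case).**
If `X ⊆ ℝⁿ` is compact and `r : X × X → ℝ^{d_r}` is continuous, then for every
`ε > 0` there exist a dimension `d` and, for each `i = 1, …, d_r`,
single-hidden-layer ReLU networks `φ⁽ⁱ⁾, ψ⁽ⁱ⁾ : X → ℝ^d`, each component being
a finite linear combination of maps `x ↦ max 0 (⟪w, x⟫ + b)`, such that the
model `r̂ (x,y)` with `i`-th component `⟪φ⁽ⁱ⁾ x, ψ⁽ⁱ⁾ y⟫` (the Euclidean inner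
product on `ℝ^d`, written as the sum `Σ_j φ⁽ⁱ⁾_j x * ψ⁽ⁱ⁾_j y`) satisfies
`sup_{x,y ∈ X} ‖r (x,y) - r̂ (x,y)‖_∞ < ε`; the `ℓ∞`-bound is expressed
componentwise. -/
theorem relu_inner_product_relation_universal_approximation_vector
    (n dr : ℕ) (hdr : 0 < dr) (X : Set (EuclideanSpace ℝ (Fin n))) (hX : IsCompact X)
    (r : EuclideanSpace ℝ (Fin n) × EuclideanSpace ℝ (Fin n) → (Fin dr → ℝ))
    (hr : ContinuousOn r (X ×ˢ X)) (ε : ℝ) (hε : 0 < ε) :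
    ∃ (d m m' : ℕ)
      (a : Fin dr → Fin d → Fin m → ℝ)
      (w : Fin dr → Fin d → Fin m → EuclideanSpace ℝ (Fin n))
      (b : Fin dr → Fin d → Fin m → ℝ)
      (c : Fin dr → Fin d → Fin m' → ℝ)
      (v : Fin dr → Fin d → Fin m' → EuclideanSpace ℝ (Fin n))
      (u : Fin dr → Fin d → Fin m' → ℝ),
      ∀ x ∈ X, ∀ y ∈ X, ∀ i : Fin dr,
        |r (x, y) i -
          ∑ j : Fin d,
            (∑ k : Fin m, a i j k * max 0 (⟪w i j k, x⟫ + b i j k)) *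
            (∑ k : Fin m', c i j k * max 0 (⟪v i j k, y⟫ + u i j k))| < ε := by
  have : CompactSpace X := isCompact_iff_compactSpace.1 hX
  let f : Fin dr → C(X × X, ℝ) := fun i =>
    ⟨fun z => r (z.1, z.2) i, (continuous_apply i).comp
      (hr.comp_continuous (by fun_prop) fun z => ⟨z.1.2, z.2.2⟩)⟩
  have happrox : ∀ i, ∃ l : ((EuclideanSpace ℝ (Fin n) × ℝ) ×
      (EuclideanSpace ℝ (Fin n) × ℝ)) →₀ ℝ,
      ‖f i - l.sum fun p t => t • reluProd X p‖ < ε := fun i => by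
    have hmem : f i ∈ (Submodule.span ℝ (Set.range (reluProd X))).topologicalClosure := by
      rw [topologicalClosure_span_reluProd]
      trivial
    obtain ⟨g, hg, hfg⟩ := Metric.mem_closure_iff.1 hmem ε hε
    obtain ⟨l, rfl⟩ := Finsupp.mem_span_range_iff_exists_finsupp.1 hg
    exact ⟨l, by rwa [← dist_eq_norm]⟩
  choose l hl using happrox
  classical
  let S := Finset.univ.biUnion fun i => (l i).support
  let e := S.equivFin.symm
  refine ⟨S.card, 1, 1, fun i j _ => l i (e j), fun _ j _ => (e j).1.1.1,
    fun _ j _ => (e j).1.1.2, fun _ _ _ => 1, fun _ j _ => (e j).1.2.1,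
    fun _ j _ => (e j).1.2.2, fun x hx y hy i => ?_⟩
  refine lt_of_eq_of_lt ?_
    (((f i - (l i).sum fun p t => t • reluProd X p).norm_coe_le_norm
      (⟨x, hx⟩, ⟨y, hy⟩)).trans_lt (hl i))
  have hsum : ((l i).sum fun p t => t • reluProd X p) =
      ∑ j, l i (e j) • reluProd X (e j) := by
    rw [Finsupp.sum_of_support_subset (l i) (s := S)
      (Finset.subset_biUnion_of_mem (fun i => (l i).support) (Finset.mem_univ i)) _ (by simp),
      e.sum_comp fun p : S => l i p • reluProd X p,
      S.sum_coe_sort fun p => l i p • reluProd X p]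
  rw [hsum, Real.norm_eq_abs]
  simp [f, reluProd, mul_assoc]
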